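/- Let U : K₁ ⥤ K₂ be a categorical precompact expansion of categories. Suppose that for every object A of K₂ there exists an object B of K₂ such that (B^i choose A^j) is nonempty for every expansion B^i of B and every expansion A^j of A (the homogeneous condition). Then for every object A of K₂ whose expansions A^0, …, A^{m(A)−1} all have finite Ramsey degree in K₁, one has m(A) ≤ t_{K₂}(A) ≤ Σ_{i < m(A)} t_{K₁}(A^i). -/

import Mathlib

open CategoryTheory

universe v₁ v₂ u₁ u₂ v u

namespace CatRamsey

variable {C : Type u} [Category.{v} C]

/-- Two morphisms `f, h : A ⟶ B` are equivalent if `f ∘ g = h` for some automorphism `g` of `A`. -/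
def copySetoid (A B : C) : Setoid (A ⟶ B) where
  r f h := ∃ g : A ≅ A, g.hom ≫ f = h
  iseqv := by
    constructor
    · intro f
      exact ⟨Iso.refl A, by simp⟩
    · rintro f h ⟨g, hg⟩
      refine ⟨g.symm, ?_⟩
      rw [← hg, ← Category.assoc, Iso.symm_hom, g.inv_hom_id, Category.id_comp]
    · rintro f h k ⟨g₁, h₁⟩ ⟨g₂, h₂⟩
      exact ⟨g₂ ≪≫ g₁, by rw [Iso.trans_hom, Category.assoc, h₁, h₂]⟩

/-- The set of copies of `A` in `B`: `Hom(A,B)` modulo precomposition with automorphisms. -/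
def Copies (A B : C) := Quotient (copySetoid A B)

/-- The copy determined by a morphism. -/
def copyMk {A B : C} (f : A ⟶ B) : Copies A B := Quotient.mk (copySetoid A B) f

/-- `D → (B)^A_{k,t}` : for every colouring `χ` of the copies of `A` in `D` with `k` colours,
there is `f : B ⟶ D` such that `χ` takes at most `t` values on the copies of `A` in the
image of `B` under `f`. -/
def ArrowsRamsey (A B D : C) (k t : ℕ) : Prop :=
  ∀ χ : Copies A D → Fin k, ∃ f : B ⟶ D,
    (χ '' {c : Copies A D | ∃ h : A ⟶ B, c = copyMk (h ≫ f)}).ncard ≤ t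

/-- The Ramsey degree of `A` in `C` : the least `t` such that for every `B` and every number
of colours `k` there is a `D` with `D → (B)^A_{k,t}`; `⊤` if no such `t` exists. -/
noncomputable def ramseyDegree (A : C) : ℕ∞ :=
  sInf {t : ℕ∞ | ∃ t' : ℕ, t = (t' : ℕ∞) ∧ ∀ (B : C) (k : ℕ), ∃ D : C, ArrowsRamsey A B D k t'}

/-- An expansion functor: faithful (C), surjective on objects (Proj), and satisfying the
reflection condition (Ref) with a unique reflecting expansion. -/
def IsExpansionFunctor {K₁ : Type u₁} {K₂ : Type u₂} [Category.{v₁} K₁] [Category.{v₂} K₂]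
    (U : K₁ ⥤ K₂) : Prop :=
  (∀ (A B : K₁), Function.Injective (fun f : A ⟶ B => U.map f)) ∧
  (∀ A : K₂, ∃ A' : K₁, U.obj A' = A) ∧
  (∀ (A B : K₂) (f : A ⟶ B) (B' : K₁) (hB : U.obj B' = B),
    ∃ (A' : K₁) (hA : U.obj A' = A),
      (∃ (f' : A' ⟶ B') (g : A ≅ A), g.hom ≫ eqToHom hA.symm ≫ U.map f' ≫ eqToHom hB = f) ∧
      ∀ (A'' : K₁) (hA' : U.obj A'' = A),
        (∃ (f' : A'' ⟶ B') (g : A ≅ A),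
          g.hom ≫ eqToHom hA'.symm ≫ U.map f' ≫ eqToHom hB = f) → A'' = A')

/-- A categorical precompact expansion: an expansion functor all of whose fibres on objects
are finite. -/
def IsPrecompactExpansion {K₁ : Type u₁} {K₂ : Type u₂} [Category.{v₁} K₁] [Category.{v₂} K₂]
    (U : K₁ ⥤ K₂) : Prop :=
  IsExpansionFunctor U ∧ ∀ A : K₂, Finite {A' : K₁ // U.obj A' = A}

section SingleCategory

variable {C : Type u} [Category.{v} C]

theorem copyMk_iso_comp {A B : C} (g : A ≅ A) (f : A ⟶ B) :
    copyMk (g.hom ≫ f) = copyMk f :=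
  (Quotient.sound (s := copySetoid A B) ⟨g, rfl⟩).symm

/-- The map on copies of `A` induced by postcomposition with `f`. -/
def Copies.postcomp (A : C) {B D : C} (f : B ⟶ D) : Copies A B → Copies A D :=
  Quotient.lift (s := copySetoid A B) (fun h => copyMk (h ≫ f)) (by
    rintro h _ ⟨g, rfl⟩
    simp only [Category.assoc, copyMk_iso_comp])

theorem Copies.postcomp_copyMk {A B D : C} (h : A ⟶ B) (f : B ⟶ D) :
    Copies.postcomp A f (copyMk h) = copyMk (h ≫ f) :=
  rfl

theorem image_copies_eq_range {α : Type*} {A B D : C} (χ : Copies A D → α) (f : B ⟶ D) :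
    χ '' {c : Copies A D | ∃ h : A ⟶ B, c = copyMk (h ≫ f)} =
      Set.range (fun h : A ⟶ B => χ (copyMk (h ≫ f))) := by
  ext x
  constructor
  · rintro ⟨_, ⟨h, rfl⟩, rfl⟩
    exact ⟨h, rfl⟩
  · rintro ⟨h, rfl⟩
    exact ⟨_, ⟨h, rfl⟩, rfl⟩

theorem arrowsRamsey_iff {A B D : C} {k t : ℕ} :
    ArrowsRamsey A B D k t ↔ ∀ χ : Copies A D → Fin k, ∃ f : B ⟶ D,
      (Set.range (fun h : A ⟶ B => χ (copyMk (h ≫ f)))).ncard ≤ t := by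
  simp only [ArrowsRamsey, image_copies_eq_range]

/-- A finite Ramsey degree is attained. -/
theorem exists_ramseyDegree_eq_natCast {A : C} (hA : ramseyDegree A ≠ ⊤) :
    ∃ t : ℕ, ramseyDegree A = t ∧ ∀ (B : C) (k : ℕ), ∃ D : C, ArrowsRamsey A B D k t := by
  refine csInf_mem (s := {t : ℕ∞ | ∃ t' : ℕ, t = (t' : ℕ∞) ∧
    ∀ (B : C) (k : ℕ), ∃ D : C, ArrowsRamsey A B D k t'}) ?_
  by_contra h
  rw [Set.not_nonempty_iff_eq_empty] at h
  exact hA (by rw [ramseyDegree, h, sInf_empty])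

/-- Finitely many Ramsey properties can be realised simultaneously. -/
theorem exists_simultaneous_ramsey {ι : Type*} (X : ι → C) (t : ι → ℕ) (s : Finset ι)
    (hX : ∀ i ∈ s, ∀ (B : C) (k : ℕ), ∃ D : C, ArrowsRamsey (X i) B D k (t i))
    (B : C) (k : ℕ) :
    ∃ D : C, ∀ χ : ∀ i, Copies (X i) D → Fin k, ∃ f : B ⟶ D, ∀ i ∈ s,
      (Set.range (fun h : X i ⟶ B => χ i (copyMk (h ≫ f)))).ncard ≤ t i := by
  classical
  induction s using Finset.induction_on with
  | empty => exact ⟨B, fun _ => ⟨𝟙 B, by simp⟩⟩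
  | insert a s _ ih =>
    obtain ⟨D₁, hD₁⟩ := ih fun i hi => hX i (Finset.mem_insert_of_mem hi)
    obtain ⟨D, hD⟩ := hX a (Finset.mem_insert_self a s) D₁ k
    rw [arrowsRamsey_iff] at hD
    refine ⟨D, fun χ => ?_⟩
    obtain ⟨f₁, hf₁⟩ := hD (χ a)
    obtain ⟨f, hf⟩ := hD₁ fun i => χ i ∘ Copies.postcomp (X i) f₁
    refine ⟨f ≫ f₁, fun i hi => ?_⟩
    rcases Finset.mem_insert.1 hi with rfl | hi
    · refine (Set.ncard_le_ncard ?_ (Set.toFinite _)).trans hf₁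
      rintro _ ⟨h, rfl⟩
      exact ⟨h ≫ f, by simp only [Category.assoc]⟩
    · simpa only [Function.comp_apply, Copies.postcomp_copyMk, Category.assoc] using hf i hi

end SingleCategory

section Expansion

variable {K₁ : Type u₁} {K₂ : Type u₂} [Category.{v₁} K₁] [Category.{v₂} K₂] {U : K₁ ⥤ K₂}

/-- The map on copies induced by a functor and an identification `φ : A ≅ U.obj X`. -/
def Copies.mapFunctor (U : K₁ ⥤ K₂) {A : K₂} {X : K₁} (φ : A ≅ U.obj X) (D : K₁) :
    Copies X D → Copies A (U.obj D) :=
  Quotient.lift (s := copySetoid X D) (fun h => copyMk (φ.hom ≫ U.map h)) (by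
    rintro h _ ⟨g, rfl⟩
    rw [← copyMk_iso_comp (φ ≪≫ U.mapIso g ≪≫ φ.symm)]
    simp)

theorem Copies.mapFunctor_copyMk {A : K₂} {X D : K₁} (φ : A ≅ U.obj X) (h : X ⟶ D) :
    Copies.mapFunctor U φ D (copyMk h) = copyMk (φ.hom ≫ U.map h) :=
  rfl

/-- `Reflects U f X` says that `f` factors, up to an automorphism of its source, as the image of
a morphism out of the expansion `X`. -/
def Reflects (U : K₁ ⥤ K₂) {A : K₂} {D : K₁} (f : A ⟶ U.obj D)
    (X : {A' : K₁ // U.obj A' = A}) : Prop :=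
  ∃ (g : A ≅ A) (f' : X.1 ⟶ D), g.hom ≫ (eqToIso X.2.symm).hom ≫ U.map f' = f

theorem IsExpansionFunctor.existsUnique_reflects (hU : IsExpansionFunctor U) {A : K₂} {D : K₁}
    (f : A ⟶ U.obj D) : ∃! X, Reflects U f X := by
  obtain ⟨A', hA, ⟨f', g, hf⟩, huniq⟩ := hU.2.2 A _ f D rfl
  refine ⟨⟨A', hA⟩, ⟨g, f', by simpa using hf⟩, ?_⟩
  rintro ⟨A'', hA''⟩ ⟨g', f'', hf'⟩
  exact Subtype.ext (huniq A'' hA'' ⟨f'', g', by simpa using hf'⟩)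

theorem Reflects.iso_comp {A : K₂} {D : K₁} {f : A ⟶ U.obj D} {X : {A' : K₁ // U.obj A' = A}}
    (h : Reflects U f X) (g : A ≅ A) : Reflects U (g.hom ≫ f) X := by
  obtain ⟨g', f', rfl⟩ := h
  exact ⟨g ≪≫ g', f', by simp⟩

/-- The expansion of `A` reflecting a copy of `A` in `U.obj D`. -/
noncomputable def reflectingExpansion (hU : IsExpansionFunctor U) (A : K₂) (D : K₁) :
    Copies A (U.obj D) → {A' : K₁ // U.obj A' = A} :=
  Quotient.lift (s := copySetoid A (U.obj D))
    (fun f => (hU.existsUnique_reflects f).choose) (by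
      rintro f _ ⟨g, rfl⟩
      exact (hU.existsUnique_reflects (g.hom ≫ f)).unique
        ((hU.existsUnique_reflects f).choose_spec.1.iso_comp g)
        (hU.existsUnique_reflects (g.hom ≫ f)).choose_spec.1)

theorem Reflects.reflectingExpansion_copyMk (hU : IsExpansionFunctor U) {A : K₂} {D : K₁}
    {f : A ⟶ U.obj D} {X : {A' : K₁ // U.obj A' = A}} (h : Reflects U f X) :
    reflectingExpansion hU A D (copyMk f) = X :=
  (hU.existsUnique_reflects f).unique (hU.existsUnique_reflects f).choose_spec.1 h

/-- If every expansion of `A` embeds into every expansion of some `B`, then the Ramsey degree of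
`A` is at least the number of expansions of `A`. -/
theorem IsExpansionFunctor.card_le_ramseyDegree (hU : IsExpansionFunctor U) {A B : K₂}
    (hB : ∀ B' : K₁, U.obj B' = B → ∀ A' : K₁, U.obj A' = A → Nonempty (A' ⟶ B'))
    {m : ℕ} (e : Fin m ≃ {A' : K₁ // U.obj A' = A}) : (m : ℕ∞) ≤ ramseyDegree A := by
  refine le_sInf ?_
  rintro _ ⟨t, rfl, ht⟩
  obtain ⟨D, hD⟩ := ht B m
  obtain ⟨D, rfl⟩ := hU.2.1 D
  rw [arrowsRamsey_iff] at hD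
  obtain ⟨f, hf⟩ := hD fun c => e.symm (reflectingExpansion hU A D c)
  obtain ⟨B', ⟨g, f', rfl⟩, -⟩ := hU.existsUnique_reflects f
  rw [Set.range_eq_univ.2, Set.ncard_univ, Nat.card_fin] at hf
  · exact_mod_cast hf
  intro i
  obtain ⟨h⟩ := hB B'.1 B'.2 (e i).1 (e i).2
  refine ⟨(eqToIso (e i).2.symm).hom ≫ U.map h ≫ (eqToIso B'.2.symm).inv ≫ g.inv, ?_⟩
  rw [Equiv.symm_apply_eq]
  exact Reflects.reflectingExpansion_copyMk hU ⟨Iso.refl A, h ≫ f', by simp⟩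

/-- The Ramsey degree of `A` is at most the sum of the Ramsey degrees of its expansions. -/
theorem IsExpansionFunctor.ramseyDegree_le_sum (hU : IsExpansionFunctor U) {A : K₂}
    {m : ℕ} (e : Fin m ≃ {A' : K₁ // U.obj A' = A})
    (hfin : ∀ i, ramseyDegree (e i).1 ≠ ⊤) :
    ramseyDegree A ≤ ∑ i, ramseyDegree (e i).1 := by
  choose t ht hram using fun i => exists_ramseyDegree_eq_natCast (hfin i)
  refine sInf_le ⟨∑ i, t i, by simp [ht], fun B k => ?_⟩
  obtain ⟨B, rfl⟩ := hU.2.1 B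
  obtain ⟨D, hD⟩ := exists_simultaneous_ramsey (fun i => (e i).1) t Finset.univ
    (fun i _ => hram i) B k
  refine ⟨U.obj D, arrowsRamsey_iff.2 fun χ => ?_⟩
  obtain ⟨f, hf⟩ := hD fun i => χ ∘ Copies.mapFunctor U (eqToIso (e i).2.symm) D
  refine ⟨U.map f, ?_⟩
  refine (Set.ncard_le_ncard (t := ⋃ i, Set.range fun h : (e i).1 ⟶ B =>
    (χ ∘ Copies.mapFunctor U (eqToIso (e i).2.symm) D) (copyMk (h ≫ f))) ?_
    (Set.toFinite _)).trans ?_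
  · rintro _ ⟨h, rfl⟩
    obtain ⟨X, ⟨g, h', rfl⟩, -⟩ := hU.existsUnique_reflects h
    obtain ⟨i, rfl⟩ := e.surjective X
    refine Set.mem_iUnion.2 ⟨i, h', ?_⟩
    simp only [Function.comp_apply, Copies.mapFunctor_copyMk, Category.assoc, copyMk_iso_comp,
      Functor.map_comp]
  · exact (Set.ncard_iUnion_le_of_fintype _).trans
      (Finset.sum_le_sum fun i hi => hf i hi)

end Expansion

end CatRamsey

open CatRamsey

/-- Let `U : K₁ ⥤ K₂` be a categorical precompact expansion satisfying the
homogeneous condition: for every object `A` of `K₂` there is an object `B` of `K₂` such that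
every expansion of `A` embeds into every expansion of `B`.  Then for every `A` whose
expansions all have finite Ramsey degree in `K₁`,
`m(A) ≤ t_{K₂}(A) ≤ ∑_{i < m(A)} t_{K₁}(A^i)`. -/
theorem ramseyDegree_bounds_of_precompactExpansion
    {K₁ : Type u₁} {K₂ : Type u₂} [Category.{v₁} K₁] [Category.{v₂} K₂]
    (U : K₁ ⥤ K₂) (hU : IsPrecompactExpansion U)
    (hhom : ∀ A : K₂, ∃ B : K₂, ∀ (B' : K₁), U.obj B' = B → ∀ (A' : K₁), U.obj A' = A →
      Nonempty (A' ⟶ B'))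
    (A : K₂) (m : ℕ) (e : Fin m ≃ {A' : K₁ // U.obj A' = A})
    (hfin : ∀ i : Fin m, ramseyDegree ((e i : {A' : K₁ // U.obj A' = A}) : K₁) ≠ ⊤) :
    (m : ℕ∞) ≤ ramseyDegree A ∧
      ramseyDegree A ≤ ∑ i : Fin m, ramseyDegree ((e i : {A' : K₁ // U.obj A' = A}) : K₁) := by
  obtain ⟨B, hB⟩ := hhom A
  exact ⟨hU.1.card_le_ramseyDegree hB e, hU.1.ramseyDegree_le_sum e hfin⟩
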